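/- In the 1-dimensional standard model: let t = 𝓘⁻¹∏_{F∈𝓕}ℚ, let V be a ℚ-vector space, and let N → t ⊗_ℚ V be a map of ∏_{F∈𝓕}ℚ-modules which becomes an isomorphism after inverting 𝓘. Set N̂ = ∏_{F∈𝓕} e_F N. Then the commutative square with corners N, t⊗V, N̂, 𝓘⁻¹N̂ (with N → N̂ the completion map and N̂ → 𝓘⁻¹N̂ the localization) is a pullback square of abelian groups. -/

import Mathlib

open scoped TensorProduct

/-- The idempotent of `∏_{F ∈ ι} ℚ` with support `U`. -/
noncomputable def eU {ι : Type} (U : Set ι) : ι → ℚ :=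
  Set.indicator U (fun _ => (1 : ℚ))

/-- The multiplicatively closed set `𝓘` of idempotents of `∏_{F ∈ ι} ℚ`
with cofinite support. -/
noncomputable def Icof (ι : Type) : Submonoid (ι → ℚ) where
  carrier := {f | ∃ U : Set ι, Uᶜ.Finite ∧ f = eU U}
  one_mem' := ⟨Set.univ, by simp, by funext x; simp [eU]⟩
  mul_mem' := by
    rintro f g ⟨U, hU, rfl⟩ ⟨V, hV, rfl⟩
    refine ⟨U ∩ V, ?_, ?_⟩
    · rw [Set.compl_inter]; exact hU.union hV
    · funext x
      by_cases hx1 : x ∈ U <;> by_cases hx2 : x ∈ V <;>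
        simp [eU, Set.indicator_apply, hx1, hx2]

/-- `t = 𝓘⁻¹ ∏_{F ∈ ι} ℚ` as a `ℚ`-algebra. -/
noncomputable instance tAlgQ (ι : Type) : Algebra ℚ (Localization (Icof ι)) :=
  ((algebraMap (ι → ℚ) (Localization (Icof ι))).comp
    (algebraMap ℚ (ι → ℚ))).toAlgebra

/-- `t ⊗_ℚ V` as a module over `R = ∏_{F ∈ ι} ℚ`, via `R → t`. -/
noncomputable instance tensorModR (ι : Type) (V : Type) [AddCommGroup V]
    [Module ℚ V] :
    Module (ι → ℚ) ((Localization (Icof ι)) ⊗[ℚ] V) :=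
  Module.compHom _ (algebraMap (ι → ℚ) (Localization (Icof ι)))

/-- `e_F N`: the image of the idempotent `e_F` on `N`, realised as the
submodule of elements fixed by `e_F`. -/
noncomputable def eComp (ι : Type) (N : Type) [AddCommGroup N]
    [Module (ι → ℚ) N] (F : ι) : Submodule (ι → ℚ) N where
  carrier := {m | eU {F} • m = m}
  zero_mem' := smul_zero _
  add_mem' := by
    intro a b ha hb
    simp only [Set.mem_setOf_eq] at *
    rw [smul_add, ha, hb]
  smul_mem' := by
    intro c m hm
    simp only [Set.mem_setOf_eq] at *
    rw [smul_smul, mul_comm, ← smul_smul, hm]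

/-- The completion `N̂ = ∏_F e_F N`. -/
noncomputable def Nhat (ι : Type) (N : Type) [AddCommGroup N]
    [Module (ι → ℚ) N] : Type :=
  (F : ι) → eComp ι N F

noncomputable instance (ι : Type) (N : Type) [AddCommGroup N]
    [Module (ι → ℚ) N] : AddCommGroup (Nhat ι N) :=
  Pi.addCommGroup

noncomputable instance (ι : Type) (N : Type) [AddCommGroup N]
    [Module (ι → ℚ) N] : Module (ι → ℚ) (Nhat ι N) :=
  Pi.module _ _ _

/-- The completion map `N → N̂ = ∏_F e_F N`, `m ↦ (e_F • m)_F`. -/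
noncomputable def completionMap (ι : Type) (N : Type) [AddCommGroup N]
    [Module (ι → ℚ) N] : N →ₗ[ι → ℚ] Nhat ι N where
  toFun m := fun F => ⟨eU {F} • m, by
    simp only [eComp, Submodule.mem_mk, AddSubmonoid.mem_mk,
      AddSubsemigroup.mem_mk, Set.mem_setOf_eq]
    rw [smul_smul]
    congr 1
    funext x
    by_cases hx : x ∈ ({F} : Set ι) <;> simp [eU, Set.indicator_apply, hx]⟩
  map_add' := by
    intro a b
    funext F
    exact Subtype.ext (smul_add _ a b)
  map_smul' := by
    intro c m
    funext F
    apply Subtype.ext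
    show eU {F} • (c • m) = c • (eU {F} • m)
    rw [smul_smul, smul_smul, mul_comm]

theorem eU_mul_eU {ι : Type} (U W : Set ι) : eU U * eU W = eU (U ∩ W) := by
  funext x
  by_cases hx1 : x ∈ U <;> by_cases hx2 : x ∈ W <;>
    simp [eU, Set.indicator_apply, hx1, hx2]

theorem eU_empty {ι : Type} : eU (∅ : Set ι) = 0 := by
  funext x
  simp [eU]

theorem eU_add_sum {ι : Type} (U : Set ι) (hU : Uᶜ.Finite) :
    eU U + ∑ F ∈ hU.toFinset, eU {F} = 1 := by
  classical
  funext x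
  by_cases hx : x ∈ U <;>
    simp [eU, Set.indicator_apply, hx, Finset.sum_apply]

/-- Elements of `𝓘` act as the identity on a module where they are invertible. -/
theorem Icof_smul_eq {ι : Type} {N M : Type} [AddCommGroup N] [Module (ι → ℚ) N]
    [AddCommMonoid M] [Module (ι → ℚ) M] (φ : N →ₗ[ι → ℚ] M)
    (hφ : IsLocalizedModule (Icof ι) φ) (s : Icof ι) (x : M) :
    (s : ι → ℚ) • x = x := by
  have h := IsLocalizedModule.smul_injective φ s
  apply h
  obtain ⟨s, U, hU, rfl⟩ := s
  change eU U • (eU U • x) = eU U • x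
  rw [smul_smul, eU_mul_eU, Set.inter_self]

theorem eComp_fixed {ι N : Type} [AddCommGroup N] [Module (ι → ℚ) N] {F : ι}
    (m : eComp ι N F) : eU {F} • (m : N) = m := m.2

theorem eComp_other {ι N : Type} [AddCommGroup N] [Module (ι → ℚ) N] {F : ι}
    (m : eComp ι N F) (U : Set ι) (h : F ∉ U) : eU U • (m : N) = 0 := by
  rw [← eComp_fixed m, smul_smul, eU_mul_eU, Set.inter_singleton_eq_empty.2 h,
    eU_empty, zero_smul]

theorem eComp_same {ι N : Type} [AddCommGroup N] [Module (ι → ℚ) N] {F : ι}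
    (m : eComp ι N F) (U : Set ι) (h : F ∈ U) : eU U • (m : N) = m := by
  conv_lhs => rw [← eComp_fixed m]
  rw [smul_smul, eU_mul_eU,
    Set.inter_eq_right.2 (Set.singleton_subset_iff.2 h), eComp_fixed]

theorem map_eComp_eq_zero {ι : Type} {N M : Type} [AddCommGroup N] [Module (ι → ℚ) N]
    [AddCommMonoid M] [Module (ι → ℚ) M] (φ : N →ₗ[ι → ℚ] M)
    (hφ : IsLocalizedModule (Icof ι) φ) {F : ι} (m : eComp ι N F) :
    φ (m : N) = 0 := by
  have h := Icof_smul_eq φ hφ ⟨eU {F}ᶜ, {F}ᶜ, by simp, rfl⟩ (φ (m : N))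
  rw [← h, ← map_smul]
  change φ (eU {F}ᶜ • (m : N)) = 0
  rw [eComp_other m _ (by simp), map_zero]

theorem completion_unique {ι : Type} {N M : Type} [AddCommGroup N] [Module (ι → ℚ) N]
    [AddCommMonoid M] [Module (ι → ℚ) M] (φ : N →ₗ[ι → ℚ] M)
    (hφ : IsLocalizedModule (Icof ι) φ) (d : N) (h1 : φ d = 0)
    (h2 : completionMap ι N d = 0) : d = 0 := by
  obtain ⟨⟨s, U, hU, rfl⟩, hs⟩ := (IsLocalizedModule.eq_zero_iff (Icof ι) φ).1 h1
  replace hs : eU U • d = 0 := hs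
  have h3 : ∀ F, eU {F} • d = 0 := fun F => congrArg Subtype.val (congrFun h2 F)
  rw [← one_smul (ι → ℚ) d, ← eU_add_sum U hU, add_smul, Finset.sum_smul, hs]
  simp [h3]

/-- The 1-dimensional standard model pullback: given an `R = ∏_{F∈𝓕} ℚ`-module
map `φ : N → t ⊗_ℚ V` which exhibits `t ⊗ V` as the localization `𝓘⁻¹N`
(i.e. becomes an isomorphism after inverting `𝓘`), and any map
`ψ : t ⊗ V → 𝓘⁻¹N̂` making the square with the completion map
`c : N → N̂` and the localization `N̂ → 𝓘⁻¹N̂` commute, the square is a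
pullback of abelian groups: for `x ∈ t ⊗ V` and `y ∈ N̂` with equal images in
`𝓘⁻¹N̂` there is a unique `n ∈ N` with `φ n = x` and `c n = y`. -/
theorem stmt9 (ι : Type) [Countable ι] [Infinite ι]
    (V : Type) [AddCommGroup V] [Module ℚ V]
    (N : Type) [AddCommGroup N] [Module (ι → ℚ) N]
    (φ : N →ₗ[ι → ℚ] (Localization (Icof ι)) ⊗[ℚ] V)
    (hφ : IsLocalizedModule (Icof ι) φ)
    (ψ : ((Localization (Icof ι)) ⊗[ℚ] V) →ₗ[ι → ℚ]
        LocalizedModule (Icof ι) (Nhat ι N))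
    (hψ : ∀ n : N,
      ψ (φ n) = LocalizedModule.mkLinearMap (Icof ι) (Nhat ι N)
        (completionMap ι N n)) :
    ∀ (x : (Localization (Icof ι)) ⊗[ℚ] V) (y : Nhat ι N),
      ψ x = LocalizedModule.mkLinearMap (Icof ι) (Nhat ι N) y →
        ∃! n : N, φ n = x ∧ completionMap ι N n = y := by
  classical
  intro x y hxy
  obtain ⟨⟨n0, s0⟩, h0⟩ := hφ.surj x
  replace h0 : φ n0 = x := by
    rw [← Icof_smul_eq φ hφ s0 x]; exact h0.symm
  have h1 : LocalizedModule.mkLinearMap (Icof ι) (Nhat ι N) (y - completionMap ι N n0) = 0 := by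
    rw [map_sub, ← hψ, h0, hxy, sub_self]
  obtain ⟨⟨s, U, hU, rfl⟩, hs⟩ := (IsLocalizedModule.eq_zero_iff (Icof ι) _).1 h1
  set d : Nhat ι N := y - completionMap ι N n0 with hd
  replace hs : ∀ F, eU U • (d F : N) = 0 := fun F => congrArg Subtype.val (congrFun hs F)
  have hc : completionMap ι N (∑ F ∈ hU.toFinset, (d F : N)) = d := by
    funext F'
    apply Subtype.ext
    change eU {F'} • (∑ F ∈ hU.toFinset, (d F : N)) = d F'
    rw [Finset.smul_sum]
    by_cases hF : F' ∈ U
    · rw [← eComp_same (d F') U hF, hs]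
      apply Finset.sum_eq_zero
      intro F hF2
      apply eComp_other
      rintro rfl
      simp at hF2
      exact hF2 hF
    · rw [Finset.sum_eq_single F', eComp_fixed]
      · intro F _ hne
        exact eComp_other _ _ (by simpa using hne)
      · intro h
        simp [hF] at h
  refine ⟨n0 + ∑ F ∈ hU.toFinset, (d F : N), ⟨?_, ?_⟩, ?_⟩
  · rw [map_add, h0, map_sum, Finset.sum_eq_zero, add_zero]
    intro F _
    exact map_eComp_eq_zero φ hφ (d F)
  · rw [map_add, hc, hd, add_sub_cancel]
  · rintro n ⟨hn1, hn2⟩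
    rw [← sub_eq_zero]
    apply completion_unique φ hφ
    · rw [map_sub, map_add, hn1, h0, map_sum, Finset.sum_eq_zero, add_zero, sub_self]
      intro F _
      exact map_eComp_eq_zero φ hφ (d F)
    · rw [map_sub, map_add, hc, hd, add_sub_cancel, hn2, sub_self]
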